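/- Let K ⊆ ℝ³ be a compact set satisfying the interior ball condition at its boundary: for every point p in the frontier of K there exist c ∈ ℝ³ and ρ > 0 such that the closed ball of center c and radius ρ is contained in K and ‖p − c‖ = ρ. Let Ω = ℝ³ ∖ K. Then there exists a function G : ℝ³ → ℝ that is continuous on the closure of Ω, harmonic on Ω, equal to 0 at every point of the frontier of Ω, and satisfying G(x) → 1 as ‖x‖ → ∞. -/

import Mathlib

open Filter

/-- Euclidean 3-space. -/
noncomputable abbrev E3 := EuclideanSpace ℝ (Fin 3)

/-- The Laplacian of `u : E3 → ℝ` at `x`: the trace of the Hessian, computed as the sum of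
the pure second derivatives in the standard coordinate directions. -/
noncomputable def laplacian (u : E3 → ℝ) (x : E3) : ℝ :=
  ∑ i : Fin 3, iteratedFDeriv ℝ 2 u x ![EuclideanSpace.single i 1, EuclideanSpace.single i 1]

/-- `u` is harmonic on `Ω`: it is `C²` on `Ω` and its Laplacian vanishes on `Ω`. -/
def HarmonicOn (u : E3 → ℝ) (Ω : Set E3) : Prop :=
  ContDiffOn ℝ 2 u Ω ∧ ∀ x ∈ Ω, laplacian u x = 0

open MeasureTheory Set Topology Metric
open scoped ContDiff

/-- An unnormalized smooth radial bump supported in the closed unit ball. -/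
noncomputable def bump (y : E3) : ℝ := 2 * deriv expNegInvGlue (1 - ‖y‖ ^ 2)

/-- The radial probability density obtained by normalizing `bump`. -/
noncomputable def kernel (y : E3) : ℝ := bump y / ∫ z, bump z

/-- The compactly supported function whose gradient at `y` is `-kernel y • y`. -/
noncomputable def kernelPotential (y : E3) : ℝ :=
  expNegInvGlue (1 - ‖y‖ ^ 2) / ∫ z, bump z

lemma contDiff_deriv_expNegInvGlue : ContDiff ℝ ∞ (deriv expNegInvGlue) :=
  (contDiff_infty_iff_deriv.1 (expNegInvGlue.contDiff (n := ⊤))).2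

lemma contDiff_one_sub_norm_sq : ContDiff ℝ ∞ (fun y : E3 => 1 - ‖y‖ ^ 2) :=
  contDiff_const.sub (contDiff_norm_sq ℝ)

lemma contDiff_bump : ContDiff ℝ ∞ bump :=
  contDiff_const.mul (contDiff_deriv_expNegInvGlue.comp contDiff_one_sub_norm_sq)

lemma contDiff_kernel : ContDiff ℝ ∞ kernel := contDiff_bump.div_const _

lemma contDiff_kernelPotential : ContDiff ℝ ∞ kernelPotential :=
  ((expNegInvGlue.contDiff (n := ⊤)).comp contDiff_one_sub_norm_sq).div_const _

lemma bump_nonneg (y : E3) : 0 ≤ bump y :=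
  mul_nonneg zero_le_two expNegInvGlue.monotone.deriv_nonneg

lemma deriv_expNegInvGlue_of_nonpos {t : ℝ} (ht : t ≤ 0) : deriv expNegInvGlue t = 0 := by
  have : IsLocalMin expNegInvGlue t := by
    refine Filter.Eventually.of_forall fun s => ?_
    rw [expNegInvGlue.zero_of_nonpos ht]
    exact expNegInvGlue.nonneg s
  exact this.deriv_eq_zero

lemma one_sub_norm_sq_nonpos {y : E3} (hy : 1 ≤ ‖y‖) : 1 - ‖y‖ ^ 2 ≤ 0 := by nlinarith

lemma bump_eq_zero {y : E3} (hy : 1 ≤ ‖y‖) : bump y = 0 := by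
  rw [bump, deriv_expNegInvGlue_of_nonpos (one_sub_norm_sq_nonpos hy), mul_zero]

lemma kernel_eq_zero {y : E3} (hy : 1 ≤ ‖y‖) : kernel y = 0 := by
  rw [kernel, bump_eq_zero hy, zero_div]

lemma kernelPotential_eq_zero {y : E3} (hy : 1 ≤ ‖y‖) : kernelPotential y = 0 := by
  rw [kernelPotential, expNegInvGlue.zero_of_nonpos (one_sub_norm_sq_nonpos hy), zero_div]

lemma hasCompactSupport_of_one_le_norm {f : E3 → ℝ} (hf : ∀ y, 1 ≤ ‖y‖ → f y = 0) :
    HasCompactSupport f := by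
  refine HasCompactSupport.intro (isCompact_closedBall (0 : E3) 1) fun y hy => hf y ?_
  rw [mem_closedBall_zero_iff, not_le] at hy
  exact hy.le

lemma hasCompactSupport_kernel : HasCompactSupport kernel :=
  hasCompactSupport_of_one_le_norm fun _ => kernel_eq_zero

lemma hasCompactSupport_kernelPotential : HasCompactSupport kernelPotential :=
  hasCompactSupport_of_one_le_norm fun _ => kernelPotential_eq_zero

lemma integral_bump_pos : 0 < ∫ z, bump z := by
  obtain ⟨t, ht, h⟩ := exists_deriv_eq_slope expNegInvGlue (zero_lt_one (α := ℝ))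
    (expNegInvGlue.contDiff (n := 0)).continuous.continuousOn
    ((expNegInvGlue.contDiff (n := 1)).differentiable (by simp)).differentiableOn
  refine contDiff_bump.continuous.integral_pos_of_hasCompactSupport_nonneg_nonzero
    (hasCompactSupport_of_one_le_norm fun _ => bump_eq_zero) bump_nonneg
    (x := EuclideanSpace.single 0 (√(1 - t))) ?_
  have h1 := expNegInvGlue.pos_of_pos one_pos
  have : 0 ≤ 1 - t := by linarith [ht.2]
  simp only [bump, PiLp.norm_single, Real.norm_eq_abs, sq_abs, Real.sq_sqrt this,
    sub_sub_cancel, h, expNegInvGlue.zero, sub_zero, div_one]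
  positivity

lemma kernel_nonneg (y : E3) : 0 ≤ kernel y :=
  div_nonneg (bump_nonneg y) integral_bump_pos.le

lemma kernelPotential_nonneg (y : E3) : 0 ≤ kernelPotential y :=
  div_nonneg (expNegInvGlue.nonneg _) integral_bump_pos.le

lemma integrable_kernel : Integrable kernel :=
  contDiff_kernel.continuous.integrable_of_hasCompactSupport hasCompactSupport_kernel

lemma integrable_kernelPotential : Integrable kernelPotential :=
  contDiff_kernelPotential.continuous.integrable_of_hasCompactSupport
    hasCompactSupport_kernelPotential

lemma integral_kernel : ∫ y, kernel y = 1 := by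
  simp only [kernel, integral_div]
  exact div_self integral_bump_pos.ne'

lemma integral_kernelPotential_pos : 0 < ∫ y, kernelPotential y := by
  refine contDiff_kernelPotential.continuous.integral_pos_of_hasCompactSupport_nonneg_nonzero
    hasCompactSupport_kernelPotential kernelPotential_nonneg (x := 0) ?_
  refine (div_pos (expNegInvGlue.pos_of_pos ?_) integral_bump_pos).ne'
  simp

lemma fderiv_kernelPotential (y z : E3) :
    fderiv ℝ kernelPotential y z = -(kernel y * inner ℝ y z) := by
  have h1 : HasFDerivAt (fun y : E3 => 1 - ‖y‖ ^ 2) (-(2 • innerSL ℝ y)) y :=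
    (hasStrictFDerivAt_norm_sq y).hasFDerivAt.const_sub 1
  have h2 : HasDerivAt expNegInvGlue (deriv expNegInvGlue (1 - ‖y‖ ^ 2)) (1 - ‖y‖ ^ 2) :=
    (((expNegInvGlue.contDiff (n := 1)).differentiable (by simp)) _).hasDerivAt
  have h3 := (h2.comp_hasFDerivAt y h1).mul_const (∫ z, bump z)⁻¹
  have h4 : kernelPotential = fun y => (expNegInvGlue ∘ fun y : E3 => 1 - ‖y‖ ^ 2) y *
    (∫ z, bump z)⁻¹ := by
    ext y; simp [kernelPotential, div_eq_mul_inv]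
  rw [h4, h3.fderiv]
  simp [kernel, bump]
  ring

/-- The average of `f` around `x` at scale `t`, weighted by `kernel`. -/
noncomputable def avg (t : ℝ) (f : E3 → ℝ) (x : E3) : ℝ := ∫ y, kernel y * f (x + t • y)

lemma laplacian_eq_sum_fderiv {h : E3 → ℝ} {x : E3} (hh : ContDiffAt ℝ 2 h x) :
    laplacian h x = ∑ i : Fin 3, fderiv ℝ (fun y => fderiv ℝ h y (EuclideanSpace.single i 1)) x
      (EuclideanSpace.single i 1) := by
  have hd : DifferentiableAt ℝ (fderiv ℝ h) x :=
    (hh.fderiv_right (m := 1) (by norm_num)).differentiableAt (by simp)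
  refine Finset.sum_congr rfl fun i _ => ?_
  rw [iteratedFDeriv_two_apply, fderiv_clm_apply hd (by fun_prop)]
  simp

lemma contDiff_fderiv_apply {n : WithTop ℕ∞} {h : E3 → ℝ} (hh : ContDiff ℝ (n + 1) h) (e : E3) :
    ContDiff ℝ n (fun y => fderiv ℝ h y e) :=
  (hh.fderiv_right le_rfl).clm_apply contDiff_const

lemma continuous_laplacian {h : E3 → ℝ} (hh : ContDiff ℝ 2 h) : Continuous (laplacian h) := by
  rw [show laplacian h = _ from funext fun x => laplacian_eq_sum_fderiv hh.contDiffAt]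
  refine continuous_finsetSum _ fun i _ => ?_
  exact (contDiff_fderiv_apply (n := 0) (contDiff_fderiv_apply (n := 1) (by simpa using! hh) _)
    _).continuous

/-- A continuous function times a continuous compactly supported one is integrable. -/
lemma integrable_mul_of_hasCompactSupport {k f : E3 → ℝ} (hk : Continuous k)
    (hks : HasCompactSupport k) (hf : Continuous f) : Integrable fun y => k y * f y :=
  (hk.mul hf).integrable_of_hasCompactSupport hks.mul_right

lemma EuclideanSpace.clm_apply_eq_sum (L : E3 →L[ℝ] ℝ) (y : E3) :
    L y = ∑ i : Fin 3, y i * L (EuclideanSpace.single i 1) := by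
  conv_lhs => rw [← (EuclideanSpace.basisFun (Fin 3) ℝ).sum_repr y]
  simp

lemma integral_kernel_mul_fderiv {h : E3 → ℝ} (hh : ContDiff ℝ 2 h) (x : E3) (t : ℝ) :
    ∫ y, kernel y * fderiv ℝ h (x + t • y) y =
      t * ∫ y, kernelPotential y * laplacian h (x + t • y) := by
  have hcd : ∀ i : Fin 3, ContDiff ℝ 1
      (fun y => fderiv ℝ h y (EuclideanSpace.single i 1)) :=
    fun i => contDiff_fderiv_apply (by simpa using! hh) _
  have haff : ContDiff ℝ 1 (fun y : E3 => x + t • y) := by fun_prop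
  have hd : ∀ i : Fin 3, ContDiff ℝ 1
      (fun y => fderiv ℝ h (x + t • y) (EuclideanSpace.single i 1)) :=
    fun i => (hcd i).comp haff
  have hcd0 : ∀ i : Fin 3, Continuous (fun y => fderiv ℝ
      (fun y => fderiv ℝ h y (EuclideanSpace.single i 1)) (x + t • y)
        (EuclideanSpace.single i 1)) := fun i =>
    (contDiff_fderiv_apply (n := 0) (by simpa using! hcd i) _).continuous.comp haff.continuous
  have key : ∀ i : Fin 3,
      ∫ y, kernel y * (y i * fderiv ℝ h (x + t • y) (EuclideanSpace.single i 1)) =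
      ∫ y, t * (kernelPotential y * fderiv ℝ
        (fun y => fderiv ℝ h y (EuclideanSpace.single i 1)) (x + t • y)
          (EuclideanSpace.single i 1)) := by
    intro i
    have hchain : ∀ y, fderiv ℝ
        (fun y => fderiv ℝ h (x + t • y) (EuclideanSpace.single i 1)) y
          (EuclideanSpace.single i 1) = t * fderiv ℝ
        (fun y => fderiv ℝ h y (EuclideanSpace.single i 1)) (x + t • y)
          (EuclideanSpace.single i 1) := by
      intro y
      have h1 : HasFDerivAt (fun y : E3 => x + t • y) (t • ContinuousLinearMap.id ℝ E3) y :=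
        ((hasFDerivAt_id y).const_smul t).const_add x
      have h2 := (((hcd i).differentiable (by simp)) (x + t • y)).hasFDerivAt.comp y h1
      rw [show (fun y => fderiv ℝ h (x + t • y) (EuclideanSpace.single i 1)) =
        (fun y => fderiv ℝ h y (EuclideanSpace.single i 1)) ∘ (fun y : E3 => x + t • y) from rfl,
        h2.fderiv]
      simp
    have hp : ∀ y, fderiv ℝ kernelPotential y (EuclideanSpace.single i 1) = -(kernel y * y i) := by
      intro y
      rw [fderiv_kernelPotential]
      simp [EuclideanSpace.inner_single_right]
    have hpc : Continuous fun y : E3 => kernel y * y i :=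
      contDiff_kernel.continuous.mul (by fun_prop)
    have := integral_mul_fderiv_eq_neg_fderiv_mul_of_integrable (μ := (volume : Measure E3))
      (f := fun y => fderiv ℝ h (x + t • y) (EuclideanSpace.single i 1))
      (g := kernelPotential) (v := EuclideanSpace.single i 1) ?_ ?_ ?_ ?_ ?_
    · simp only [hp, hchain] at this
      rw [← neg_inj, ← integral_neg, ← integral_neg]
      rw [← integral_neg] at this
      refine Eq.trans (integral_congr_ae (Filter.Eventually.of_forall fun y => ?_))
        (this.trans (integral_congr_ae (Filter.Eventually.of_forall fun y => ?_))) <;>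
      · dsimp only
        ring
    · simp only [hchain]
      convert integrable_mul_of_hasCompactSupport contDiff_kernelPotential.continuous
        hasCompactSupport_kernelPotential ((hcd0 i).const_mul t) using 2
      ring
    · simp only [hp]
      convert integrable_mul_of_hasCompactSupport contDiff_kernel.continuous
        hasCompactSupport_kernel
        ((hd i).continuous.mul (g := fun y : E3 => -y i) (by fun_prop)) using 2
      simp only [Pi.mul_apply]
      ring
    · convert integrable_mul_of_hasCompactSupport contDiff_kernelPotential.continuous
        hasCompactSupport_kernelPotential (hd i).continuous using 2
      ring
    · exact fun y _ => (hd i).differentiable (by simp) y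
    · exact fun y _ => contDiff_kernelPotential.differentiable (by simp) y
  have hL : ∀ y, kernel y * fderiv ℝ h (x + t • y) y = ∑ i : Fin 3,
      kernel y * (y i * fderiv ℝ h (x + t • y) (EuclideanSpace.single i 1)) := fun y => by
    rw [EuclideanSpace.clm_apply_eq_sum (fderiv ℝ h _), Finset.mul_sum]
  rw [← integral_const_mul]
  simp only [hL, laplacian_eq_sum_fderiv hh.contDiffAt, Finset.mul_sum]
  rw [integral_finsetSum, integral_finsetSum]
  · exact Finset.sum_congr rfl fun i _ => key i
  · intro i _
    exact (integrable_mul_of_hasCompactSupport contDiff_kernelPotential.continuous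
        hasCompactSupport_kernelPotential (hcd0 i)).const_mul t
  · intro i _
    exact integrable_mul_of_hasCompactSupport contDiff_kernel.continuous
        hasCompactSupport_kernel
        (Continuous.mul (f := fun y : E3 => y i) (by fun_prop) (hd i).continuous)

lemma hasDerivAt_avg {h : E3 → ℝ} (hh : ContDiff ℝ 2 h) (x : E3) (t : ℝ) :
    HasDerivAt (fun s => avg s h x)
      (t * ∫ y, kernelPotential y * laplacian h (x + t • y)) t := by
  rw [← integral_kernel_mul_fderiv hh]
  have hc : Continuous (fderiv ℝ h) := hh.continuous_fderiv (by simp)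
  have hcont : Continuous fun p : ℝ × E3 => fderiv ℝ h (x + p.1 • p.2) p.2 := by fun_prop
  obtain ⟨M, hM⟩ := ((isCompact_closedBall t 1).prod
    (isCompact_closedBall (0 : E3) 1)).exists_bound_of_continuousOn hcont.continuousOn
  refine (hasDerivAt_integral_of_dominated_loc_of_deriv_le
    (F := fun s (y : E3) => kernel y * h (x + s • y))
    (F' := fun s (y : E3) => kernel y * fderiv ℝ h (x + s • y) y) (s := closedBall t 1)
    (bound := fun y => kernel y * M) (closedBall_mem_nhds t one_pos) ?_ ?_ ?_ ?_
    (integrable_kernel.mul_const M) ?_).2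
  · refine Filter.Eventually.of_forall fun s => ?_
    exact (contDiff_kernel.continuous.mul (hh.continuous.comp (by fun_prop))).aestronglyMeasurable
  · exact integrable_mul_of_hasCompactSupport contDiff_kernel.continuous
      hasCompactSupport_kernel (hh.continuous.comp (by fun_prop))
  · exact (contDiff_kernel.continuous.mul
      (hcont.comp (by fun_prop : Continuous fun y : E3 => (t, y)))).aestronglyMeasurable
  · refine Filter.Eventually.of_forall fun y s hs => ?_
    rw [norm_mul, Real.norm_of_nonneg (kernel_nonneg y)]
    rcases le_or_gt 1 ‖y‖ with hy | hy
    · simp [kernel_eq_zero hy]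
    · exact mul_le_mul_of_nonneg_left
        (hM (s, y) ⟨hs, mem_closedBall_zero_iff.2 hy.le⟩) (kernel_nonneg y)
  · refine Filter.Eventually.of_forall fun y s _ => ?_
    refine HasDerivAt.const_mul _ ?_
    have h1 : HasDerivAt (fun s : ℝ => x + s • y) y s := by
      simpa using! ((hasDerivAt_id s).smul_const y).const_add x
    exact ((hh.differentiable (by simp)) _).hasFDerivAt.comp_hasDerivAt s h1

lemma avg_zero (f : E3 → ℝ) (x : E3) : avg 0 f x = f x := by
  simp [avg, integral_mul_const, integral_kernel]

/-- The mean value property of harmonic functions. -/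
lemma avg_eq_of_laplacian_eq_zero {h : E3 → ℝ} (hh : ContDiff ℝ 2 h) {x : E3} {r t : ℝ}
    (h0 : ∀ z ∈ ball x r, laplacian h z = 0) (ht : |t| < r) : avg t h x = h x := by
  have hr : 0 < r := (abs_nonneg t).trans_lt ht
  have := Convex.norm_image_sub_le_of_norm_hasDerivWithin_le (s := ball (0 : ℝ) r) (C := 0)
    (x := 0) (y := t) (fun s _ => (hasDerivAt_avg hh x s).hasDerivWithinAt) ?_
    (convex_ball _ _) (mem_ball_self hr) (by simpa using ht)
  · rw [avg_zero] at this
    simpa [sub_eq_zero] using this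
  · intro s hs
    rw [mem_ball_zero_iff, Real.norm_eq_abs] at hs
    rw [show ∫ y, kernelPotential y * laplacian h (x + s • y) = 0 from ?_]
    · simp
    · refine integral_eq_zero_of_ae (Filter.Eventually.of_forall fun y => ?_)
      rcases le_or_gt 1 ‖y‖ with hy | hy
      · simp [kernelPotential_eq_zero hy]
      · beta_reduce
        rw [h0, mul_zero, Pi.zero_apply]
        · rw [mem_ball, dist_self_add_left, norm_smul, Real.norm_eq_abs]
          nlinarith [abs_nonneg s, norm_nonneg y]

/-- The second order Taylor expansion of `avg t f x` in `t`, uniformly in `x`. -/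
lemma exists_abs_avg_sub_le {f : E3 → ℝ} (hf : ContDiff ℝ 2 f) (hs : HasCompactSupport f)
    {η : ℝ} (hη : 0 < η) :
    ∃ δ > 0, ∀ t, |t| < δ → ∀ x,
      |avg t f x - f x - t ^ 2 / 2 * (∫ y, kernelPotential y) * laplacian f x| ≤ η * t ^ 2 := by
  set κ := ∫ y, kernelPotential y with hκdef
  have hκ : 0 < κ := integral_kernelPotential_pos
  have hlc := continuous_laplacian hf
  have hls : HasCompactSupport (laplacian f) := by
    refine hs.mono' fun x hx => ?_
    by_contra hx'
    refine hx ?_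
    have : ∀ i : Fin 3, iteratedFDeriv ℝ 2 f x
      ![EuclideanSpace.single i 1, EuclideanSpace.single i 1] = 0 := by
      intro i
      rw [Function.notMem_support.1 fun h => hx' (support_iteratedFDeriv_subset 2 h)]
      rfl
    simp [laplacian, this]
  obtain ⟨δ, hδ, hu⟩ := Metric.uniformContinuous_iff.1
    (hls.uniformContinuous_of_continuous hlc) (η / κ) (by positivity)
  refine ⟨δ, hδ, fun t ht x => ?_⟩
  have hder : ∀ s, HasDerivAt (fun s => avg s f x - s ^ 2 / 2 * κ * laplacian f x)
      (s * ∫ y, kernelPotential y * (laplacian f (x + s • y) - laplacian f x)) s := by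
    intro s
    have h1 : HasDerivAt (fun s : ℝ => s ^ 2 / 2 * κ * laplacian f x)
        (s * (κ * laplacian f x)) s := by
      refine (((((hasDerivAt_id s).fun_pow 2).div_const 2).mul_const κ).mul_const
        (laplacian f x)).congr_deriv ?_
      simp
      ring
    refine ((hasDerivAt_avg hf x s).fun_sub h1).congr_deriv ?_
    rw [← mul_sub, hκdef, ← integral_mul_const, ← integral_sub]
    · simp_rw [mul_sub]
    · exact integrable_mul_of_hasCompactSupport contDiff_kernelPotential.continuous
        hasCompactSupport_kernelPotential (hlc.comp (by fun_prop))
    · exact integrable_kernelPotential.mul_const _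
  have := Convex.norm_image_sub_le_of_norm_hasDerivWithin_le (s := closedBall (0 : ℝ) |t|)
    (C := |t| * η) (x := 0) (y := t) (fun s _ => (hder s).hasDerivWithinAt) ?_
    (convex_closedBall _ _) (by simp) (by simp)
  · simp only [avg_zero] at this
    norm_num [Real.norm_eq_abs] at this
    calc _ = |avg t f x - t ^ 2 / 2 * κ * laplacian f x - f x| := by ring_nf
      _ ≤ |t| * η * |t| := this
      _ = η * t ^ 2 := by rw [← sq_abs t]; ring
  · intro s hs'
    rw [mem_closedBall_zero_iff, Real.norm_eq_abs] at hs'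
    rw [norm_mul, Real.norm_eq_abs]
    refine mul_le_mul hs' ?_ (norm_nonneg _) (abs_nonneg t)
    calc _ ≤ ∫ y, kernelPotential y * (η / κ) := by
          refine norm_integral_le_of_norm_le (integrable_kernelPotential.mul_const _)
            (Filter.Eventually.of_forall fun y => ?_)
          rw [norm_mul, Real.norm_of_nonneg (kernelPotential_nonneg y)]
          rcases le_or_gt 1 ‖y‖ with hy | hy
          · simp [kernelPotential_eq_zero hy]
          · refine mul_le_mul_of_nonneg_left ?_ (kernelPotential_nonneg y)
            rw [← dist_eq_norm]
            refine (hu ?_).le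
            rw [dist_self_add_left, norm_smul, Real.norm_eq_abs]
            nlinarith [abs_nonneg s, norm_nonneg y]
      _ = η := by rw [integral_mul_const, ← hκdef]; field_simp

lemma laplacian_congr_of_eventuallyEq {f g : E3 → ℝ} {x : E3} (h : f =ᶠ[𝓝 x] g) :
    laplacian f x = laplacian g x := by
  simp only [laplacian, (h.iteratedFDeriv ℝ 2).eq_of_nhds]

lemma add_smul_mem_closedBall {x y : E3} {t : ℝ} (hy : ‖y‖ ≤ 1) :
    x + t • y ∈ closedBall x |t| := by
  rw [mem_closedBall, dist_self_add_left, norm_smul, Real.norm_eq_abs]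
  exact mul_le_of_le_one_right (abs_nonneg t) hy

lemma kernel_mul_congr {x y : E3} {t : ℝ} {f g : E3 → ℝ} (h : ∀ z ∈ closedBall x |t|, f z = g z) :
    kernel y * f (x + t • y) = kernel y * g (x + t • y) := by
  rcases le_or_gt 1 ‖y‖ with hy | hy
  · simp [kernel_eq_zero hy]
  · rw [h _ (add_smul_mem_closedBall hy.le)]

lemma avg_congr {x : E3} {t : ℝ} {f g : E3 → ℝ} (h : ∀ z ∈ closedBall x |t|, f z = g z) :
    avg t f x = avg t g x :=
  integral_congr_ae (Filter.Eventually.of_forall fun _ => kernel_mul_congr h)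

/-- The mean value property of functions that are only harmonic on a ball. -/
lemma avg_eq_of_harmonic_on_ball {h : E3 → ℝ} {x : E3} {r t : ℝ}
    (hh : ∀ z ∈ ball x r, ContDiffAt ℝ 2 h z) (h0 : ∀ z ∈ ball x r, laplacian h z = 0)
    (ht : |t| < r) : avg t h x = h x := by
  have ht0 := abs_nonneg t
  let χ : ContDiffBump x := ⟨(2 * |t| + r) / 3, (|t| + 2 * r) / 3, by linarith, by linarith⟩
  have hχ : ∀ z ∈ ball x ((2 * |t| + r) / 3), (fun z => χ z * h z) =ᶠ[𝓝 z] h := by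
    intro z hz
    filter_upwards [isOpen_ball.mem_nhds hz] with w hw
    rw [χ.one_of_mem_closedBall (ball_subset_closedBall hw), one_mul]
  have hlt : |t| < (2 * |t| + r) / 3 := by linarith
  have hsub := ball_subset_ball (x := x) (show (2 * |t| + r) / 3 ≤ r by linarith)
  have key := avg_eq_of_laplacian_eq_zero (h := fun z => χ z * h z) (x := x) (t := t)
    (r := (2 * |t| + r) / 3) ?_ ?_ hlt
  · rw [(hχ x (mem_ball_self (ht0.trans_lt hlt))).eq_of_nhds] at key
    rw [← key]
    exact avg_congr fun z hz => ((hχ z (closedBall_subset_ball hlt hz)).eq_of_nhds).symm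
  · refine contDiff_iff_contDiffAt.2 fun z => ?_
    by_cases hz : z ∈ ball x r
    · exact χ.contDiffAt.mul (hh z hz)
    · have : (fun z => χ z * h z) =ᶠ[𝓝 z] fun _ => 0 := by
        have hz' : z ∈ (closedBall x ((|t| + 2 * r) / 3))ᶜ := by
          simp only [mem_ball, mem_compl_iff, mem_closedBall, not_lt, not_le] at hz ⊢
          linarith
        filter_upwards [isClosed_closedBall.isOpen_compl.mem_nhds hz'] with w hw
        rw [χ.zero_of_le_dist, zero_mul]
        simp only [mem_compl_iff, mem_closedBall, not_le] at hw
        exact hw.le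
      exact contDiffAt_const.congr_of_eventuallyEq this
  · intro z hz
    rw [laplacian_congr_of_eventuallyEq (hχ z hz), h0 z (hsub hz)]

lemma hasFDerivAt_norm_sub_sq_rpow {c x : E3} (hx : x ≠ c) (p : ℝ) :
    HasFDerivAt (fun y : E3 => (‖y - c‖ ^ 2) ^ p)
      ((2 * p * (‖x - c‖ ^ 2) ^ (p - 1)) • innerSL ℝ (x - c)) x := by
  have h0 : ‖x - c‖ ^ 2 ≠ 0 := by simpa [sub_eq_zero] using hx
  have h1 : HasFDerivAt (fun y : E3 => ‖y - c‖ ^ 2) (2 • innerSL ℝ (x - c)) x := by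
    simpa using! ((hasFDerivAt_id x).sub_const c).norm_sq
  refine (((Real.hasDerivAt_rpow_const (p := p) (Or.inl h0)).comp_hasFDerivAt x h1)).congr_fderiv ?_
  ext z
  simp
  ring

lemma contDiffAt_norm_sub_sq_rpow {c x : E3} (hx : x ≠ c) (p : ℝ) :
    ContDiffAt ℝ 2 (fun y : E3 => (‖y - c‖ ^ 2) ^ p) x := by
  have h0 : ‖x - c‖ ^ 2 ≠ 0 := by simpa [sub_eq_zero] using hx
  exact ((contDiffAt_id.sub contDiffAt_const).norm_sq ℝ).rpow_const_of_ne h0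

lemma laplacian_norm_sub_sq_rpow {c x : E3} (hx : x ≠ c) :
    laplacian (fun y : E3 => (‖y - c‖ ^ 2) ^ (-1 / 2 : ℝ)) x = 0 := by
  rw [laplacian_eq_sum_fderiv (contDiffAt_norm_sub_sq_rpow hx _)]
  have hpos : 0 < ‖x - c‖ ^ 2 := by
    have : x - c ≠ 0 := sub_ne_zero.2 hx
    positivity
  have key : ∀ i : Fin 3, fderiv ℝ (fun y => fderiv ℝ (fun y : E3 => (‖y - c‖ ^ 2) ^ (-1 / 2 : ℝ)) y
      (EuclideanSpace.single i 1)) x (EuclideanSpace.single i 1) =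
      3 * (‖x - c‖ ^ 2) ^ (-5 / 2 : ℝ) * (x i - c i) ^ 2 - (‖x - c‖ ^ 2) ^ (-3 / 2 : ℝ) := by
    intro i
    have hev : (fun y => fderiv ℝ (fun y : E3 => (‖y - c‖ ^ 2) ^ (-1 / 2 : ℝ)) y
        (EuclideanSpace.single i 1)) =ᶠ[𝓝 x]
        fun y => (‖y - c‖ ^ 2) ^ (-3 / 2 : ℝ) * -((y - c) i) := by
      filter_upwards [isOpen_ne.mem_nhds hx] with y hy
      rw [(hasFDerivAt_norm_sub_sq_rpow hy _).fderiv]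
      norm_num [EuclideanSpace.inner_single_right]
      ring
    have h1 : HasFDerivAt (fun y : E3 => -((y - c) i)) (-(EuclideanSpace.proj i : E3 →L[ℝ] ℝ)) x :=
      (((-(EuclideanSpace.proj i : E3 →L[ℝ] ℝ)).hasFDerivAt (x := x)).add_const
        (c i)).congr_of_eventuallyEq (Filter.Eventually.of_forall fun y => by simp; ring)
    rw [hev.fderiv_eq, ((hasFDerivAt_norm_sub_sq_rpow hx _).fun_mul h1).fderiv]
    norm_num [EuclideanSpace.inner_single_right]
    ring
  rw [Finset.sum_congr rfl fun i _ => key i, Finset.sum_sub_distrib, ← Finset.mul_sum]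
  have hsum : ∑ i : Fin 3, (x i - c i) ^ 2 = ‖x - c‖ ^ 2 := by
    simp [EuclideanSpace.norm_sq_eq]
  have hrp : (‖x - c‖ ^ 2) ^ (-3 / 2 : ℝ) = (‖x - c‖ ^ 2) ^ (-5 / 2 : ℝ) * ‖x - c‖ ^ 2 := by
    rw [← Real.rpow_add_one hpos.ne']
    norm_num
  rw [hsum, hrp]
  simp
  ring

lemma norm_sub_sq_rpow_eq (c : E3) :
    (fun y : E3 => (‖y - c‖ ^ 2) ^ (-1 / 2 : ℝ)) = fun y => ‖y - c‖⁻¹ := by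
  ext y
  rw [← Real.rpow_natCast, ← Real.rpow_mul (norm_nonneg _)]
  norm_num [Real.rpow_neg_one]

lemma avg_inv_norm_sub {c x : E3} {t : ℝ} (ht : |t| < dist x c) :
    avg t (fun y => ‖y - c‖⁻¹) x = ‖x - c‖⁻¹ := by
  have hne : ∀ z ∈ ball x (dist x c), z ≠ c := by
    rintro z hz rfl
    rw [mem_ball, dist_comm] at hz
    exact hz.false
  rw [← norm_sub_sq_rpow_eq]
  rw [avg_eq_of_harmonic_on_ball (fun z hz => contDiffAt_norm_sub_sq_rpow (hne z hz) _)
    (fun z hz => laplacian_norm_sub_sq_rpow (hne z hz)) ht]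
  exact congrFun (norm_sub_sq_rpow_eq c) x

/-- Measurable functions with values in the unit interval. -/
def IsUnitMeasurable (f : E3 → ℝ) : Prop := Measurable f ∧ ∀ x, f x ∈ Icc (0 : ℝ) 1

lemma IsUnitMeasurable.norm_le {f : E3 → ℝ} (hf : IsUnitMeasurable f) (x : E3) : ‖f x‖ ≤ 1 := by
  rw [Real.norm_of_nonneg (hf.2 x).1]
  exact (hf.2 x).2

lemma IsUnitMeasurable.integrable_mul {f k : E3 → ℝ} (hf : IsUnitMeasurable f)
    (hk : Integrable k) : Integrable fun y => k y * f y :=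
  hk.mul_bdd (c := 1) hf.1.aestronglyMeasurable (Filter.Eventually.of_forall hf.norm_le)

lemma IsUnitMeasurable.comp_add_smul {f : E3 → ℝ} (hf : IsUnitMeasurable f) (x : E3) (t : ℝ) :
    IsUnitMeasurable fun y => f (x + t • y) :=
  ⟨hf.1.comp (by fun_prop), fun _ => hf.2 _⟩

lemma IsUnitMeasurable.integrable_kernel_mul {f : E3 → ℝ} (hf : IsUnitMeasurable f) (x : E3)
    (t : ℝ) : Integrable fun y => kernel y * f (x + t • y) :=
  (hf.comp_add_smul x t).integrable_mul integrable_kernel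

lemma avg_mono {f g : E3 → ℝ} (hf : IsUnitMeasurable f) (hg : IsUnitMeasurable g)
    (x : E3) (t : ℝ) (h : ∀ z ∈ closedBall x |t|, f z ≤ g z) : avg t f x ≤ avg t g x := by
  refine integral_mono (hf.integrable_kernel_mul x t) (hg.integrable_kernel_mul x t) fun y => ?_
  rcases le_or_gt 1 ‖y‖ with hy | hy
  · simp [kernel_eq_zero hy]
  · exact mul_le_mul_of_nonneg_left (h _ (add_smul_mem_closedBall hy.le)) (kernel_nonneg y)

lemma avg_nonneg {f : E3 → ℝ} (hf : ∀ x, 0 ≤ f x) (x : E3) (t : ℝ) : 0 ≤ avg t f x :=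
  integral_nonneg fun y => mul_nonneg (kernel_nonneg y) (hf _)

lemma avg_const (a : ℝ) (x : E3) (t : ℝ) : avg t (fun _ => a) x = a := by
  simp [avg, integral_mul_const, integral_kernel]

lemma isUnitMeasurable_one : IsUnitMeasurable fun _ => 1 :=
  ⟨measurable_const, fun _ => ⟨zero_le_one, le_rfl⟩⟩

lemma avg_le_one {f : E3 → ℝ} (hf : IsUnitMeasurable f) (x : E3) (t : ℝ) : avg t f x ≤ 1 :=
  (avg_mono hf isUnitMeasurable_one x t fun z _ => (hf.2 z).2).trans_eq (avg_const 1 x t)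

lemma IsUnitMeasurable.avg {f : E3 → ℝ} (hf : IsUnitMeasurable f) (t : ℝ) :
    IsUnitMeasurable (avg t f) := by
  refine ⟨?_, fun x => ⟨avg_nonneg (fun z => (hf.2 z).1) x t, avg_le_one hf x t⟩⟩
  have : Measurable fun p : E3 × E3 => kernel p.2 * f (p.1 + t • p.2) :=
    (contDiff_kernel.continuous.measurable.comp measurable_snd).mul (hf.1.comp (by fun_prop))
  exact this.stronglyMeasurable.integral_prod_right.measurable

open Classical in
/-- Replace the values of `f` on `X` by its averages at scale `t`. -/
noncomputable def averageOn (t : ℝ) (X : Set E3) (f : E3 → ℝ) (x : E3) : ℝ :=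
  if x ∈ X then avg t f x else f x

lemma averageOn_mono {f g : E3 → ℝ} (hf : IsUnitMeasurable f) (hg : IsUnitMeasurable g)
    (t : ℝ) (X : Set E3) (h : ∀ z, f z ≤ g z) (x : E3) : averageOn t X f x ≤ averageOn t X g x := by
  unfold averageOn
  split_ifs
  · exact avg_mono hf hg x t fun z _ => h z
  · exact h x

lemma IsUnitMeasurable.averageOn {f : E3 → ℝ} (hf : IsUnitMeasurable f) (t : ℝ) {X : Set E3}
    (hX : MeasurableSet X) : IsUnitMeasurable (averageOn t X f) := by
  refine ⟨Measurable.ite hX (hf.avg t).1 hf.1, fun x => ?_⟩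
  unfold _root_.averageOn
  split_ifs
  exacts [(hf.avg t).2 x, hf.2 x]

/-- Above a function `s` lying below its averages on `X` there is a function equal to its
averages on `X`, which is below every `T ≥ s` lying above its averages on `X`. -/
lemma exists_avg_eq_on {t : ℝ} {X : Set E3} (hX : MeasurableSet X) {s : E3 → ℝ}
    (hs : IsUnitMeasurable s) (hsub : ∀ x ∈ X, s x ≤ avg t s x) :
    ∃ v, IsUnitMeasurable v ∧ (∀ x, s x ≤ v x) ∧ (∀ x ∈ X, avg t v x = v x) ∧
      ∀ T, IsUnitMeasurable T → (∀ x, s x ≤ T x) → (∀ x ∈ X, avg t T x ≤ T x) →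
        ∀ x, v x ≤ T x := by
  let u : ℕ → E3 → ℝ := fun n => (averageOn t X)^[n] s
  have hu_succ : ∀ n, u (n + 1) = averageOn t X (u n) := fun n =>
    Function.iterate_succ_apply' _ _ _
  have hu : ∀ n, IsUnitMeasurable (u n) := by
    intro n
    induction n with
    | zero => exact hs
    | succ n ih => rw [hu_succ]; exact ih.averageOn t hX
  have hstep : ∀ n x, u n x ≤ u (n + 1) x := by
    intro n
    induction n with
    | zero =>
      intro x
      rw [hu_succ]
      unfold averageOn
      split_ifs with hx
      · exact hsub x hx
      · exact le_rfl
    | succ n ih =>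
      intro x
      rw [hu_succ, hu_succ (n + 1)]
      exact averageOn_mono (hu n) (hu (n + 1)) t X ih x
  have hmono : ∀ x, Monotone fun n => u n x := fun x => monotone_nat_of_le_succ fun n => hstep n x
  have hbdd : ∀ x, BddAbove (range fun n => u n x) := fun x =>
    ⟨1, by rintro _ ⟨n, rfl⟩; exact ((hu n).2 x).2⟩
  have hlim : ∀ x, Tendsto (fun n => u n x) atTop (𝓝 (⨆ n, u n x)) := fun x =>
    tendsto_atTop_ciSup (hmono x) (hbdd x)
  have hv : IsUnitMeasurable fun x => ⨆ n, u n x :=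
    ⟨Measurable.iSup fun n => (hu n).1, fun x => ⟨((hu 0).2 x).1.trans (le_ciSup (hbdd x) 0),
      ciSup_le fun n => ((hu n).2 x).2⟩⟩
  refine ⟨_, hv, fun x => le_ciSup (hbdd x) 0, fun x hx => ?_, fun T hT hsT hsup x => ?_⟩
  · have h1 : Tendsto (fun n => avg t (u n) x) atTop (𝓝 (avg t (fun x => ⨆ n, u n x) x)) := by
      refine tendsto_integral_of_dominated_convergence kernel
        (fun n => ((hu n).integrable_kernel_mul x t).aestronglyMeasurable) integrable_kernel
        (fun n => Filter.Eventually.of_forall fun y => ?_)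
        (Filter.Eventually.of_forall fun y => (hlim _).const_mul _)
      rw [norm_mul, Real.norm_of_nonneg (kernel_nonneg y)]
      exact mul_le_of_le_one_right (kernel_nonneg y) ((hu n).norm_le _)
    refine tendsto_nhds_unique h1 (((hlim x).comp (tendsto_add_atTop_nat 1)).congr fun n => ?_)
    simp [hu_succ, averageOn, hx]
  · refine ciSup_le fun n => ?_
    induction n generalizing x with
    | zero => exact hsT x
    | succ n ih =>
      rw [hu_succ]
      refine (averageOn_mono (hu n) hT t X ih x).trans ?_
      unfold averageOn
      split_ifs with hx
      exacts [hsup x hx, le_rfl]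

/-- The harmonic function `1 - ρ / ‖x - c‖` outside the ball of radius `ρ` around `c`,
extended by zero. -/
noncomputable def barrier (c : E3) (ρ : ℝ) (x : E3) : ℝ := max 0 ((‖x - c‖ - ρ) / ‖x - c‖)

lemma isUnitMeasurable_barrier (c : E3) {ρ : ℝ} (hρ : 0 ≤ ρ) : IsUnitMeasurable (barrier c ρ) := by
  refine ⟨by unfold barrier; fun_prop, fun x => ⟨le_max_left _ _, max_le zero_le_one ?_⟩⟩
  exact div_le_one_of_le₀ (by linarith) (norm_nonneg _)

lemma barrier_of_le {c x : E3} {ρ : ℝ} (h : ρ ≤ ‖x - c‖) :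
    barrier c ρ x = (‖x - c‖ - ρ) / ‖x - c‖ :=
  max_eq_right (div_nonneg (by linarith) (norm_nonneg _))

lemma barrier_of_ge {c x : E3} {ρ : ℝ} (h : ‖x - c‖ ≤ ρ) : barrier c ρ x = 0 :=
  max_eq_left (div_nonpos_of_nonpos_of_nonneg (by linarith) (norm_nonneg _))

lemma barrier_le_barrier {c d : E3} {ρ R : ℝ} (hρ : 0 < ρ) (h : ρ + ‖c - d‖ ≤ R) (x : E3) :
    barrier d R x ≤ barrier c ρ x := by
  rcases le_or_gt ‖x - d‖ R with hx | hx
  · rw [barrier_of_ge hx]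
    exact le_max_left _ _
  have h1 : ‖x - d‖ ≤ ‖x - c‖ + ‖c - d‖ := by
    simpa using norm_add_le (x - c) (c - d)
  have h2 : ρ < ‖x - c‖ := by linarith
  rw [barrier_of_le hx.le, barrier_of_le h2.le,
    div_le_div_iff₀ (by linarith [norm_nonneg (c - d)]) (by linarith)]
  nlinarith [norm_nonneg (c - d)]

lemma exterior_eq {c x : E3} {t : ℝ} (ρ : ℝ) (ht : |t| < dist x c) :
    ∀ z ∈ closedBall x |t|, (‖z - c‖ - ρ) / ‖z - c‖ = 1 - ρ * ‖z - c‖⁻¹ := by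
  intro z hz
  have : ‖z - c‖ ≠ 0 := by
    rw [norm_ne_zero_iff, sub_ne_zero]
    rintro rfl
    rw [mem_closedBall, dist_comm] at hz
    exact hz.not_gt ht
  field_simp

lemma integrable_kernel_mul_inv {c x : E3} {t : ℝ} (ht : |t| < dist x c) :
    Integrable fun y => kernel y * ‖x + t • y - c‖⁻¹ := by
  by_contra hni
  have := avg_inv_norm_sub ht
  rw [avg, integral_undef hni, eq_comm, inv_eq_zero, norm_eq_zero, sub_eq_zero] at this
  rw [this, dist_self] at ht
  exact (abs_nonneg t).not_gt ht

lemma integrable_kernel_mul_exterior {c x : E3} {t : ℝ} (ρ : ℝ) (ht : |t| < dist x c) :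
    Integrable fun y => kernel y * ((‖x + t • y - c‖ - ρ) / ‖x + t • y - c‖) := by
  refine (integrable_kernel.sub ((integrable_kernel_mul_inv ht).const_mul ρ)).congr
    (Filter.Eventually.of_forall fun y => ?_)
  have := kernel_mul_congr (y := y) (exterior_eq ρ ht)
  simp only [Pi.sub_apply, this]
  ring

lemma avg_exterior {c x : E3} {t : ℝ} (ρ : ℝ) (ht : |t| < dist x c) :
    avg t (fun y => (‖y - c‖ - ρ) / ‖y - c‖) x = (‖x - c‖ - ρ) / ‖x - c‖ := by
  rw [exterior_eq ρ ht x (mem_closedBall_self (abs_nonneg t)), avg_congr (exterior_eq ρ ht),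
    ← avg_inv_norm_sub ht, avg, avg]
  simp_rw [mul_sub, mul_one, mul_left_comm _ ρ]
  rw [integral_sub integrable_kernel ((integrable_kernel_mul_inv ht).const_mul ρ),
    integral_kernel, integral_const_mul]

lemma avg_barrier {c x : E3} {ρ t : ℝ} (hρ : 0 < ρ)
    (h : ∀ z ∈ closedBall x |t|, ρ < ‖z - c‖) : avg t (barrier c ρ) x = barrier c ρ x := by
  rw [avg_congr fun z hz => barrier_of_le (h z hz).le, avg_exterior,
    barrier_of_le (h x (mem_closedBall_self (abs_nonneg t))).le]
  by_contra! hc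
  have := h c (by rwa [mem_closedBall, dist_comm])
  simp at this
  linarith

lemma barrier_le_avg {c x : E3} {ρ t : ℝ} (hρ : 0 ≤ ρ) (ht : |t| < dist x c) :
    barrier c ρ x ≤ avg t (barrier c ρ) x := by
  refine max_le (avg_nonneg (fun z => le_max_left _ _) x t) ?_
  rw [← avg_exterior ρ ht]
  exact integral_mono (integrable_kernel_mul_exterior ρ ht)
    ((isUnitMeasurable_barrier c hρ).integrable_kernel_mul x t) fun y =>
    mul_le_mul_of_nonneg_left (le_max_right _ _) (kernel_nonneg y)

/-- Weak sequential limits of functions with values in the unit interval. -/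
lemma exists_weak_limit {v : ℕ → E3 → ℝ} (hv : ∀ n, IsUnitMeasurable (v n)) :
    ∃ (w : E3 → ℝ) (U : Ultrafilter ℕ), LocallyIntegrable w ∧ (U : Filter ℕ) ≤ atTop ∧
      ∀ f : E3 → ℝ, Continuous f → HasCompactSupport f →
        Tendsto (fun n => ∫ x, v n x * f x) U (𝓝 (∫ x, w x * f x)) := by
  set p : E3 → ℝ := fun x => (1 + ‖x‖) ^ 2 with hp
  have hp0 : ∀ x, 0 < p x := fun x => by positivity
  have hpc : Continuous p := by fun_prop
  have hpi : Continuous fun x => (p x)⁻¹ := hpc.inv₀ fun x => (hp0 x).ne'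
  have hq : MemLp (fun x => (p x)⁻¹) 2 (volume : Measure E3) := by
    rw [memLp_two_iff_integrable_sq hpi.aestronglyMeasurable]
    refine (integrable_one_add_norm (E := E3) (μ := volume) (r := 4) ?_).congr
      (Filter.Eventually.of_forall fun x => ?_)
    · norm_num
    · have : (0 : ℝ) < 1 + ‖x‖ := by positivity
      simp only [hp]
      rw [Real.rpow_neg this.le, show (4 : ℝ) = ((4 : ℕ) : ℝ) by norm_num, Real.rpow_natCast,
        inv_pow, ← pow_mul]
  have hle : ∀ n x, ‖v n x * (p x)⁻¹‖ ≤ ‖(p x)⁻¹‖ := fun n x => by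
    rw [norm_mul]
    exact mul_le_of_le_one_left (norm_nonneg _) ((hv n).norm_le x)
  have hg : ∀ n, MemLp (fun x => v n x * (p x)⁻¹) 2 (volume : Measure E3) := fun n =>
    hq.of_le ((hv n).1.aestronglyMeasurable.mul hpi.aestronglyMeasurable)
      (Filter.Eventually.of_forall (hle n))
  let ℓ : ℕ → WeakDual ℝ (Lp ℝ 2 (volume : Measure E3)) := fun n =>
    StrongDual.toWeakDual (InnerProductSpace.toDual ℝ _ (hg n).toLp)
  have hℓ : ∀ n, ℓ n ∈ WeakDual.toStrongDual ⁻¹'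
      closedBall (0 : StrongDual ℝ (Lp ℝ 2 (volume : Measure E3))) ‖hq.toLp‖ := by
    intro n
    rw [mem_preimage, mem_closedBall_zero_iff]
    refine ((InnerProductSpace.toDual ℝ (Lp ℝ 2 (volume : Measure E3))).norm_map _).trans_le ?_
    refine Lp.norm_le_norm_of_ae_le ?_
    filter_upwards [(hg n).coeFn_toLp, hq.coeFn_toLp] with x h1 h2
    rw [h1, h2]
    exact hle n x
  obtain ⟨L, -, hL⟩ := (WeakDual.isCompact_closedBall (𝕜 := ℝ) _ _).ultrafilter_le_nhds
    ((hyperfilter ℕ).map ℓ) (by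
      rw [Ultrafilter.coe_map, le_principal_iff, mem_map]
      exact Filter.univ_mem' hℓ)
  let z := (InnerProductSpace.toDual ℝ _).symm (WeakDual.toStrongDual L)
  refine ⟨fun x => p x * z x, hyperfilter ℕ, ?_, ?_, fun f hf hfs => ?_⟩
  · exact ((Lp.memLp z).locallyIntegrable (by norm_num)).continuous_mul hpc
  · exact Nat.hyperfilter_le_atTop
  · have hF : MemLp (fun x => p x * f x) 2 (volume : Measure E3) :=
      (hpc.mul hf).memLp_of_hasCompactSupport hfs.mul_left
    have hL' : Tendsto ℓ (hyperfilter ℕ) (𝓝 L) := hL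
    have := ((WeakDual.eval_continuous (𝕜 := ℝ) hF.toLp).tendsto L).comp hL'
    have h1 : L hF.toLp = ∫ x, p x * z x * f x := by
      rw [show L hF.toLp = inner ℝ z hF.toLp from
        (InnerProductSpace.toDual_symm_apply (y := WeakDual.toStrongDual L)).symm, L2.inner_def]
      refine integral_congr_ae ?_
      filter_upwards [hF.coeFn_toLp] with x h2
      rw [h2]
      simp
      ring
    have h2 : ∀ n, ℓ n hF.toLp = ∫ x, v n x * f x := by
      intro n
      rw [show ℓ n hF.toLp = inner ℝ (hg n).toLp hF.toLp from
        InnerProductSpace.toDual_apply_apply, L2.inner_def]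
      refine integral_congr_ae ?_
      filter_upwards [hF.coeFn_toLp, (hg n).coeFn_toLp] with x h3 h4
      rw [h3, h4]
      have := (hp0 x).ne'
      simp
      field_simp
    rw [h1] at this
    exact this.congr h2

/-- The convolution of `f` and `k`. -/
noncomputable def conv (f k : E3 → ℝ) (x : E3) : ℝ := ∫ z, f z * k (x - z)

lemma conv_eq_convolution (f k : E3 → ℝ) :
    conv f k = convolution f k (ContinuousLinearMap.mul ℝ ℝ) volume := rfl

lemma integrable_mul_comp_sub {f k : E3 → ℝ} (hf : LocallyIntegrable f) (hk : Continuous k)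
    (hks : HasCompactSupport k) (x : E3) : Integrable fun z => f z * k (x - z) :=
  hks.convolutionExists_right (ContinuousLinearMap.mul ℝ ℝ) hf hk x

lemma contDiff_conv {f k : E3 → ℝ} (hf : LocallyIntegrable f) (hk : ContDiff ℝ ∞ k)
    (hks : HasCompactSupport k) : ContDiff ℝ ∞ (conv f k) :=
  hks.contDiff_convolution_right (n := ⊤) (ContinuousLinearMap.mul ℝ ℝ) hf hk

lemma fderiv_conv {f k : E3 → ℝ} (hf : LocallyIntegrable f) (hk : ContDiff ℝ 1 k)
    (hks : HasCompactSupport k) (x e : E3) :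
    fderiv ℝ (conv f k) x e = conv f (fun z => fderiv ℝ k z e) x := by
  rw [conv_eq_convolution, (hks.hasFDerivAt_convolution_right _ hf hk x).fderiv]
  exact convolution_precompR_apply _ hf (hks.fderiv ℝ) (hk.continuous_fderiv (by simp)) x e

lemma laplacian_conv {f k : E3 → ℝ} (hf : LocallyIntegrable f) (hk : ContDiff ℝ ∞ k)
    (hks : HasCompactSupport k) (x : E3) :
    laplacian (conv f k) x = conv f (laplacian k) x := by
  have hk2 : ContDiff ℝ 2 k := hk.of_le (WithTop.coe_le_coe.2 le_top)
  have hd : ∀ e, ContDiff ℝ 1 fun y => fderiv ℝ k y e := fun e =>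
    contDiff_fderiv_apply (by simpa using! hk2) e
  have hds : ∀ e, HasCompactSupport fun y => fderiv ℝ k y e := fun e =>
    hks.fderiv_apply ℝ e
  rw [laplacian_eq_sum_fderiv ((contDiff_conv hf hk hks).of_le
    (WithTop.coe_le_coe.2 le_top)).contDiffAt]
  rw [show laplacian k = _ from funext fun x => laplacian_eq_sum_fderiv hk2.contDiffAt]
  simp only [conv, Finset.mul_sum]
  rw [integral_finsetSum]
  · refine Finset.sum_congr rfl fun i _ => ?_
    rw [show (fun y => fderiv ℝ (conv f k) y (EuclideanSpace.single i 1)) = _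
      from funext fun y => fderiv_conv hf (hk2.of_le (by norm_num)) hks y _]
    exact fderiv_conv hf (hd _) (hds _) x _
  · intro i _
    exact integrable_mul_comp_sub hf
      (contDiff_fderiv_apply (n := 0) (by simpa using! hd _) _).continuous
      ((hds _).fderiv_apply ℝ _) x

/-- The kernel rescaled to be supported in the ball of radius `t`. -/
noncomputable def scaledKernel (t : ℝ) (u : E3) : ℝ := (t ^ 3)⁻¹ * kernel (t⁻¹ • u)

lemma kernel_neg (y : E3) : kernel (-y) = kernel y := by simp [kernel, bump]

lemma scaledKernel_neg (t : ℝ) (u : E3) : scaledKernel t (-u) = scaledKernel t u := by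
  simp [scaledKernel, kernel_neg]

lemma contDiff_scaledKernel (t : ℝ) : ContDiff ℝ ∞ (scaledKernel t) :=
  contDiff_const.mul (contDiff_kernel.comp (contDiff_const_smul _))

lemma scaledKernel_eq_zero {t : ℝ} (ht : 0 < t) {u : E3} (hu : t ≤ ‖u‖) :
    scaledKernel t u = 0 := by
  rw [scaledKernel, kernel_eq_zero, mul_zero]
  rwa [norm_smul, norm_inv, Real.norm_of_nonneg ht.le, inv_mul_eq_div, one_le_div ht]

lemma hasCompactSupport_scaledKernel {t : ℝ} (ht : 0 < t) :
    HasCompactSupport (scaledKernel t) :=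
  HasCompactSupport.intro (isCompact_closedBall (0 : E3) t) fun u hu =>
    scaledKernel_eq_zero ht (by
      rw [mem_closedBall_zero_iff, not_le] at hu
      exact hu.le)

lemma avg_eq_conv {t : ℝ} (ht : 0 < t) (f : E3 → ℝ) (x : E3) :
    avg t f x = conv f (scaledKernel t) x := by
  have h1 := Measure.integral_comp_smul (volume : Measure E3)
    (fun u => kernel (t⁻¹ • u) * f (x + u)) t
  have h2 := integral_add_left_eq_self (μ := (volume : Measure E3))
    (fun z => f z * scaledKernel t (x - z)) x
  rw [conv, ← h2]
  simp only [smul_smul, inv_mul_cancel₀ ht.ne', one_smul, finrank_euclideanSpace_fin] at h1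
  rw [avg, h1, smul_eq_mul, abs_of_pos (by positivity), ← integral_const_mul]
  refine integral_congr_ae (Filter.Eventually.of_forall fun u => ?_)
  simp only [sub_add_cancel_left, scaledKernel_neg]
  simp only [scaledKernel]
  ring

lemma avg_scaledKernel_comm {s t : ℝ} (hs : 0 < s) (ht : 0 < t) (u : E3) :
    avg s (scaledKernel t) u = avg t (scaledKernel s) u := by
  rw [avg_eq_conv hs, avg_eq_conv ht, conv, conv,
    ← integral_sub_left_eq_self (fun z => scaledKernel s z * scaledKernel t (u - z)) volume u]
  refine integral_congr_ae (Filter.Eventually.of_forall fun z => ?_)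
  simp only [sub_sub_cancel]
  ring

lemma conv_congr {f g k : E3 → ℝ} {x : E3} {t : ℝ} (hk : ∀ u, t < ‖u‖ → k u = 0)
    (h : ∀ z ∈ closedBall x t, f z = g z) : conv f k x = conv g k x := by
  refine integral_congr_ae (Filter.Eventually.of_forall fun z => ?_)
  by_cases hz : z ∈ closedBall x t
  · simp only [h z hz]
  · have : t < ‖x - z‖ := by
      rwa [mem_closedBall, not_le, dist_comm, dist_eq_norm] at hz
    simp only [hk _ this, mul_zero]

lemma avg_conv {f k : E3 → ℝ} (hf : LocallyIntegrable f) (hk : Continuous k)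
    (hks : HasCompactSupport k) (s : ℝ) (x : E3) :
    avg s (conv f k) x = conv f (avg s k) x := by
  obtain ⟨r, hr⟩ := hks.isCompact.isBounded.subset_closedBall (0 : E3)
  have hk0 : ∀ u, r < ‖u‖ → k u = 0 := fun u hu => by
    by_contra hne
    have := hr (subset_tsupport k hne)
    rw [mem_closedBall_zero_iff] at this
    linarith
  obtain ⟨C, hC⟩ := hk.bounded_above_of_compact_support hks
  set B := closedBall x (r + |s|) with hB
  have hBi : Integrable (B.indicator f) := by
    rw [integrable_indicator_iff measurableSet_closedBall]
    exact hf.integrableOn_isCompact (isCompact_closedBall _ _)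
  have hz0 : ∀ y, ‖y‖ < 1 → ∀ z, z ∉ B → k (x + s • y - z) = 0 := by
    intro y hy z hz
    refine hk0 _ ?_
    rw [hB, mem_closedBall, not_le, dist_comm, dist_eq_norm] at hz
    have h1 : ‖s • y‖ ≤ |s| := by
      rw [norm_smul, Real.norm_eq_abs]
      exact mul_le_of_le_one_right (abs_nonneg s) hy.le
    have h2 : ‖x - z‖ ≤ ‖x + s • y - z‖ + ‖s • y‖ := by
      rw [show x - z = (x + s • y - z) - s • y by abel]
      exact norm_sub_le _ _
    linarith
  have hind : ∀ y z, kernel y * (f z * k (x + s • y - z)) =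
      kernel y * B.indicator f z * k (x + s • y - z) := by
    intro y z
    rcases le_or_gt 1 ‖y‖ with hy | hy
    · simp [kernel_eq_zero hy]
    · by_cases hz : z ∈ B
      · rw [indicator_of_mem hz, mul_assoc]
      · simp [hz0 y hy z hz]
  have hprod : Integrable (Function.uncurry fun y z =>
      kernel y * B.indicator f z * k (x + s • y - z)) (volume.prod volume) :=
    (integrable_kernel.mul_prod hBi).mul_bdd (c := C)
      (Continuous.aestronglyMeasurable (by fun_prop))
      (Filter.Eventually.of_forall fun p => hC _)
  simp only [avg, conv, ← integral_const_mul, hind]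
  rw [integral_integral_swap hprod]
  refine integral_congr_ae (Filter.Eventually.of_forall fun z => ?_)
  refine integral_congr_ae (Filter.Eventually.of_forall fun y => ?_)
  beta_reduce
  rw [← hind, add_sub_right_comm]
  ring

lemma conv_avg {v k : E3 → ℝ} (hv : IsUnitMeasurable v) (hk : Continuous k)
    (hks : HasCompactSupport k) (s : ℝ) (x : E3) :
    avg s (conv v k) x = conv (avg s v) k x := by
  have h1 : ∀ y, conv v k (x + s • y) = ∫ z, v (z + s • y) * k (x - z) := by
    intro y
    rw [conv, ← integral_add_right_eq_self _ (s • y)]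
    simp only [add_sub_add_right_eq_sub]
  have hki : Integrable fun z => k (x - z) :=
    (hk.integrable_of_hasCompactSupport hks).comp_sub_left x
  have hprod : Integrable (Function.uncurry fun y z =>
      kernel y * k (x - z) * v (z + s • y)) (volume.prod volume) :=
    (integrable_kernel.mul_prod hki).mul_bdd (c := 1)
      (Measurable.aestronglyMeasurable (hv.1.comp (by fun_prop)))
      (Filter.Eventually.of_forall fun p => hv.norm_le _)
  have h2 : ∀ y z, kernel y * (v (z + s • y) * k (x - z)) =
      kernel y * k (x - z) * v (z + s • y) := fun y z => by ring
  rw [avg]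
  simp only [h1, ← integral_const_mul, h2]
  rw [integral_integral_swap hprod, conv]
  refine integral_congr_ae (Filter.Eventually.of_forall fun z => ?_)
  beta_reduce
  rw [avg, ← integral_mul_const]
  refine integral_congr_ae (Filter.Eventually.of_forall fun y => ?_)
  beta_reduce
  ring

lemma IsUnitMeasurable.locallyIntegrable {f : E3 → ℝ} (hf : IsUnitMeasurable f) :
    LocallyIntegrable f := by
  refine (locallyIntegrable_const (1 : ℝ)).mono hf.1.aestronglyMeasurable
    (Filter.Eventually.of_forall fun x => ?_)
  simpa using hf.norm_le x

lemma hasCompactSupport_of_lt_norm {k : E3 → ℝ} {t : ℝ} (hk : ∀ u, t < ‖u‖ → k u = 0) :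
    HasCompactSupport k :=
  HasCompactSupport.intro (isCompact_closedBall (0 : E3) t) fun u hu => hk u (by
    rwa [mem_closedBall_zero_iff, not_le] at hu)

lemma laplacian_eq_zero_of_lt_norm {k : E3 → ℝ} {t : ℝ} (hk : ∀ u, t < ‖u‖ → k u = 0)
    {u : E3} (hu : t < ‖u‖) : laplacian k u = 0 := by
  have : k =ᶠ[𝓝 u] fun _ => 0 := by
    filter_upwards [continuous_norm.continuousAt.eventually (lt_mem_nhds hu)] with z hz
    exact hk z hz
  rw [laplacian_congr_of_eventuallyEq this]
  simp [laplacian]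

/-- Functions satisfying the mean value property at smaller and smaller scales become weakly
harmonic in the limit. -/
lemma tendsto_conv_laplacian {v : ℕ → E3 → ℝ} (hv : ∀ n, IsUnitMeasurable (v n)) {ε : ℕ → ℝ}
    (hpos : ∀ n, 0 < ε n) (hε : Tendsto ε atTop (𝓝 0)) {k : E3 → ℝ} (hk : ContDiff ℝ 2 k)
    {t : ℝ} (hk0 : ∀ u, t < ‖u‖ → k u = 0) {x : E3}
    (h : ∀ᶠ n in atTop, ∀ z ∈ closedBall x t, avg (ε n) (v n) z = v n z) :
    Tendsto (fun n => conv (v n) (laplacian k) x) atTop (𝓝 0) := by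
  have hks := hasCompactSupport_of_lt_norm hk0
  set V := volume.real (closedBall x (t + 1)) with hV
  have hV0 : 0 ≤ V := measureReal_nonneg
  have hκ := integral_kernelPotential_pos
  set κ := ∫ y, kernelPotential y with hκdef
  rw [Metric.tendsto_atTop']
  intro η hη
  obtain ⟨δ, hδ, hδk⟩ := exists_abs_avg_sub_le hk hks
    (η := η * κ / (2 * (V + 1))) (by positivity)
  have hev : ∀ᶠ n in atTop, ε n < min δ 1 :=
    hε.eventually (gt_mem_nhds (lt_min hδ zero_lt_one))
  obtain ⟨N, hN⟩ := eventually_atTop.1 (h.and hev)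
  refine ⟨N, fun n hn => ?_⟩
  obtain ⟨hmean, hεn⟩ := hN n hn.le
  have hp := hpos n
  have habs : |ε n| = ε n := abs_of_pos hp
  have hL := (hv n).locallyIntegrable
  have hav : conv (v n) (avg (ε n) k) x = conv (v n) k x := by
    rw [← avg_conv hL hk.continuous hks, conv_avg (hv n) hk.continuous hks]
    exact conv_congr hk0 hmean
  have hout : ∀ u, t + 1 < ‖u‖ → avg (ε n) k u = 0 := by
    intro u hu
    rw [← avg_const 0 u (ε n)]
    refine avg_congr fun z hz => hk0 z ?_
    rw [mem_closedBall, habs, dist_eq_norm] at hz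
    have := norm_sub_norm_le u z
    rw [norm_sub_rev] at this
    linarith [hεn.le.trans (min_le_right _ _)]
  have hlap : ∀ u, t < ‖u‖ → laplacian k u = 0 := fun u hu =>
    laplacian_eq_zero_of_lt_norm hk0 hu
  have havc : Continuous (avg (ε n) k) := by
    rw [show avg (ε n) k = _ from funext (avg_eq_conv hp k)]
    exact (contDiff_conv hk.continuous.locallyIntegrable (contDiff_scaledKernel _)
      (hasCompactSupport_scaledKernel hp)).continuous
  have i1 := integrable_mul_comp_sub hL havc (hasCompactSupport_of_lt_norm hout) x
  have i2 := integrable_mul_comp_sub hL hk.continuous hks x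
  have i3 := integrable_mul_comp_sub hL (continuous_laplacian hk)
    (hasCompactSupport_of_lt_norm hlap) x
  set r : E3 → ℝ := fun u => avg (ε n) k u - k u - (ε n) ^ 2 / 2 * κ * laplacian k u with hr
  have hconv : ∫ z, v n z * r (x - z) = -((ε n) ^ 2 / 2 * κ * conv (v n) (laplacian k) x) := by
    have : ∀ z, v n z * r (x - z) = v n z * avg (ε n) k (x - z) - v n z * k (x - z) -
        (ε n) ^ 2 / 2 * κ * (v n z * laplacian k (x - z)) := fun z => by
      simp only [hr]
      ring
    simp only [this]
    have i12 : Integrable fun z => v n z * avg (ε n) k (x - z) - v n z * k (x - z) := i1.sub i2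
    rw [integral_sub i12 (i3.const_mul _), integral_sub i1 i2, integral_const_mul]
    simp only [conv] at hav ⊢
    rw [hav]
    ring
  have hr0 : ∀ z, z ∉ closedBall x (t + 1) → v n z * r (x - z) = 0 := by
    intro z hz
    rw [mem_closedBall, not_le, dist_comm, dist_eq_norm] at hz
    simp only [hr]
    rw [hout _ hz, hk0 _ (by linarith), hlap _ (by linarith)]
    ring
  have hbound : ‖∫ z, v n z * r (x - z)‖ ≤ η * κ / (2 * (V + 1)) * (ε n) ^ 2 * V := by
    rw [← setIntegral_eq_integral_of_forall_compl_eq_zero hr0]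
    refine norm_setIntegral_le_of_norm_le_const measure_closedBall_lt_top fun z _ => ?_
    rw [norm_mul]
    refine (mul_le_of_le_one_left (norm_nonneg _) ((hv n).norm_le z)).trans ?_
    exact hδk _ (by rw [habs]; exact hεn.trans_le (min_le_left _ _)) _
  rw [hconv, norm_neg, norm_mul, Real.norm_of_nonneg (by positivity)] at hbound
  rw [dist_zero_right]
  have hfac : 0 < (ε n) ^ 2 / 2 * κ := by positivity
  refine lt_of_mul_lt_mul_left (hbound.trans_lt ?_) hfac.le
  have : η * κ / (2 * (V + 1)) * (ε n) ^ 2 * V = (ε n) ^ 2 / 2 * κ * (η * (V / (V + 1))) := by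
    field_simp
  rw [this]
  refine mul_lt_mul_of_pos_left ?_ hfac
  exact mul_lt_of_lt_one_right hη ((div_lt_one (by positivity)).2 (by linarith))

/-- A weakly harmonic function on the complement of `K`, trapped between barriers. -/
lemma exists_weakly_harmonic {K : Set E3} {x₀ : E3} {R : ℝ} (hx₀ : x₀ ∈ K) (hR0 : 0 < R)
    (hR : ∀ c ρ, 0 < ρ → closedBall c ρ ⊆ K → ρ + ‖c - x₀‖ ≤ R) :
    ∃ w : E3 → ℝ, LocallyIntegrable w ∧ ∀ x t, 0 < t → t < infDist x K →
      (∀ k : E3 → ℝ, ContDiff ℝ 2 k → (∀ u, t < ‖u‖ → k u = 0) →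
        conv w (laplacian k) x = 0) ∧
      barrier x₀ R x ≤ avg t w x ∧
      ∀ c ρ, 0 < ρ → closedBall c ρ ⊆ K → avg t w x ≤ barrier c ρ x := by
  set ε : ℕ → ℝ := fun n => 1 / ((n : ℝ) + 1) with hεdef
  have hpos : ∀ n, 0 < ε n := fun n => by positivity
  have hε : Tendsto ε atTop (𝓝 0) := tendsto_one_div_add_atTop_nhds_zero_nat
  have hs := isUnitMeasurable_barrier x₀ hR0.le
  have hsub : ∀ x t, 0 < t → t < infDist x K → barrier x₀ R x ≤ avg t (barrier x₀ R) x := by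
    intro x t ht hx
    refine barrier_le_avg hR0.le ?_
    rw [abs_of_pos ht]
    exact hx.trans_le (infDist_le_dist_of_mem hx₀)
  have hsup : ∀ c ρ, 0 < ρ → closedBall c ρ ⊆ K → ∀ x t, 0 < t → t < infDist x K →
      avg t (barrier c ρ) x = barrier c ρ x := by
    intro c ρ hρ hc x t ht hx
    refine avg_barrier hρ fun z hz => ?_
    rw [mem_closedBall, abs_of_pos ht, dist_comm] at hz
    by_contra! hle
    refine notMem_of_dist_lt_infDist (hz.trans_lt hx) (hc ?_)
    rwa [mem_closedBall, dist_eq_norm]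
  have hX : ∀ n, MeasurableSet {x | ε n < infDist x K} := fun n =>
    (isOpen_lt continuous_const (continuous_infDist_pt K)).measurableSet
  choose v hv hsv hmean hvT using fun n =>
    exists_avg_eq_on (hX n) hs fun x hx => hsub x (ε n) (hpos n) hx
  have hvb : ∀ n c ρ, 0 < ρ → closedBall c ρ ⊆ K → ∀ x, v n x ≤ barrier c ρ x :=
    fun n c ρ hρ hc => hvT n _ (isUnitMeasurable_barrier c hρ.le)
      (barrier_le_barrier hρ (hR c ρ hρ hc))
      fun x hx => (hsup c ρ hρ hc x (ε n) (hpos n) hx).le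
  obtain ⟨w, U, hw, hU, hlim⟩ := exists_weak_limit hv
  have hconv : ∀ (k : E3 → ℝ) (x : E3), Continuous k → HasCompactSupport k →
      Tendsto (fun n => conv (v n) k x) U (𝓝 (conv w k x)) := fun k x hk hks =>
    hlim (fun z => k (x - z)) (by fun_prop)
      (hks.comp_homeomorph (Homeomorph.subLeft x))
  refine ⟨w, hw, fun x t ht hx => ⟨fun k hk hk0 => ?_, ?_, fun c ρ hρ hc => ?_⟩⟩
  · refine tendsto_nhds_unique (hconv _ x (continuous_laplacian hk)
      (hasCompactSupport_of_lt_norm fun _ => laplacian_eq_zero_of_lt_norm hk0))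
      ((tendsto_conv_laplacian hv hpos hε hk hk0 ?_).mono_left hU)
    filter_upwards [hε.eventually (gt_mem_nhds (sub_pos.2 hx))] with n hn z hz
    refine hmean n z ?_
    rw [mem_closedBall, dist_comm] at hz
    have := infDist_le_infDist_add_dist (s := K) (x := x) (y := z)
    exact (show ε n < infDist z K by linarith)
  all_goals
    have hav := hconv _ x (contDiff_scaledKernel t).continuous (hasCompactSupport_scaledKernel ht)
    simp only [← avg_eq_conv ht] at hav
  · exact ge_of_tendsto' hav fun n => (hsub x t ht hx).trans
      (avg_mono hs (hv n) x t fun z _ => hsv n z)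
  · exact le_of_tendsto' hav fun n => (avg_mono (hv n) (isUnitMeasurable_barrier c hρ.le) x t
      fun z _ => hvb n c ρ hρ hc z).trans_eq (hsup c ρ hρ hc x t ht hx)

lemma exists_radius_bound {K : Set E3} (hK : IsCompact K) {x₀ : E3} (hx₀ : x₀ ∈ K) :
    ∃ R, 0 < R ∧ ∀ c ρ, 0 < ρ → closedBall c ρ ⊆ K → ρ + ‖c - x₀‖ ≤ R := by
  obtain ⟨D, hD⟩ := hK.isBounded.subset_closedBall x₀
  have hD0 : 0 ≤ D := by simpa using hD hx₀
  refine ⟨3 * D + 1, by positivity, fun c ρ hρ hc => ?_⟩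
  have h1 := hD (hc (mem_closedBall_self hρ.le))
  have h2 := hD (hc (show c + ρ • EuclideanSpace.single (0 : Fin 3) (1 : ℝ) ∈ closedBall c ρ by
    simp [norm_smul, abs_of_pos hρ]))
  rw [mem_closedBall] at h1 h2
  have h3 := dist_triangle_right (c + ρ • EuclideanSpace.single (0 : Fin 3) (1 : ℝ)) c x₀
  rw [dist_self_add_left, norm_smul, Real.norm_of_nonneg hρ.le, PiLp.norm_single,
    norm_one, mul_one] at h3
  rw [← dist_eq_norm]
  linarith

lemma tendsto_barrier (c : E3) (ρ : ℝ) : Tendsto (barrier c ρ) (cocompact E3) (𝓝 1) := by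
  have h : Tendsto (fun x : E3 => ‖x - c‖) (cocompact E3) atTop := by
    simpa [dist_eq_norm] using tendsto_dist_right_cocompact_atTop c
  have h1 : Tendsto (fun x : E3 => max 0 (1 - ρ * ‖x - c‖⁻¹)) (cocompact E3) (𝓝 1) := by
    have := (tendsto_const_nhds (x := (0 : ℝ))).max
      ((tendsto_const_nhds (x := (1 : ℝ))).sub (h.inv_tendsto_atTop.const_mul ρ))
    simpa using this
  refine h1.congr' ?_
  filter_upwards [h.eventually_gt_atTop 0] with x hx
  rw [barrier, sub_div, div_self hx.ne', div_eq_mul_inv]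

lemma continuousAt_barrier {c x : E3} (ρ : ℝ) (hx : x ≠ c) : ContinuousAt (barrier c ρ) x := by
  have : ‖x - c‖ ≠ 0 := by simpa [sub_eq_zero] using hx
  unfold barrier
  fun_prop (disch := assumption)

/-- Mollifications of a weakly harmonic function do not depend on the scale. -/
lemma avg_eq_avg_of_weakly_harmonic {K : Set E3} {w : E3 → ℝ} (hw : LocallyIntegrable w)
    (h : ∀ x t, 0 < t → t < infDist x K → laplacian (avg t w) x = 0) {x : E3} {s t : ℝ}
    (hs : 0 < s) (ht : 0 < t) (hst : s + t < infDist x K) : avg s w x = avg t w x := by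
  have key : ∀ s t, 0 < s → 0 < t → s + t < infDist x K →
      conv w (avg s (scaledKernel t)) x = avg t w x := by
    intro s t hs ht hst
    have hconv : avg t w = conv w (scaledKernel t) := funext (avg_eq_conv ht w)
    have hsm := contDiff_conv hw (contDiff_scaledKernel t) (hasCompactSupport_scaledKernel ht)
    rw [← avg_conv hw (contDiff_scaledKernel t).continuous (hasCompactSupport_scaledKernel ht),
      ← hconv]
    refine avg_eq_of_laplacian_eq_zero (r := infDist x K - t)
      (hconv ▸ hsm.of_le (WithTop.coe_le_coe.2 le_top)) (fun z hz => h z t ht ?_)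
      (by rw [abs_of_pos hs]; linarith)
    rw [mem_ball, dist_comm] at hz
    have := infDist_le_infDist_add_dist (s := K) (x := x) (y := z)
    linarith
  rw [← key s t hs ht hst, ← key t s ht hs (by linarith),
    funext (avg_scaledKernel_comm hs ht)]

/-- Existence of the Green function at infinity of an exterior domain `Ω = ℝ³ ∖ K`, where the
compact set `K` satisfies the interior ball condition at its boundary: there is a function `G`
continuous on the closure of `Ω`, harmonic on `Ω`, vanishing on the frontier of `Ω`, and
tending to `1` at infinity. -/
theorem exists_green_function_at_infinity
    (K : Set E3) (hK : IsCompact K)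
    (hball : ∀ p ∈ frontier K, ∃ (c : E3) (ρ : ℝ), 0 < ρ ∧
      Metric.closedBall c ρ ⊆ K ∧ ‖p - c‖ = ρ) :
    ∃ G : E3 → ℝ,
      ContinuousOn G (closure Kᶜ) ∧
      HarmonicOn G Kᶜ ∧
      (∀ p ∈ frontier Kᶜ, G p = 0) ∧
      Tendsto G (Filter.cocompact E3) (nhds 1) := by
  classical
  have hcl := hK.isClosed
  rcases K.eq_empty_or_nonempty with rfl | ⟨x₀, hx₀⟩
  · exact ⟨fun _ => 1, continuousOn_const, ⟨contDiffOn_const, fun x _ => by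
        simp [laplacian, iteratedFDeriv_const_of_ne (two_ne_zero)]⟩,
      by simp, tendsto_const_nhds⟩
  have hne : K.Nonempty := ⟨x₀, hx₀⟩
  obtain ⟨R, hR0, hR⟩ := exists_radius_bound hK hx₀
  obtain ⟨w, hw, hwK⟩ := exists_weakly_harmonic hx₀ hR0 hR
  have hsmooth : ∀ t, 0 < t → ContDiff ℝ 2 (avg t w) := fun t ht => by
    rw [show avg t w = _ from funext (avg_eq_conv ht w)]
    exact (contDiff_conv hw (contDiff_scaledKernel t)
      (hasCompactSupport_scaledKernel ht)).of_le (WithTop.coe_le_coe.2 le_top)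
  have hlap : ∀ x t, 0 < t → t < infDist x K → laplacian (avg t w) x = 0 := fun x t ht hx => by
    rw [show avg t w = _ from funext (avg_eq_conv ht w), laplacian_conv hw
      (contDiff_scaledKernel t) (hasCompactSupport_scaledKernel ht)]
    exact (hwK x t ht hx).1 _ ((contDiff_scaledKernel t).of_le (WithTop.coe_le_coe.2 le_top))
      fun u hu => scaledKernel_eq_zero ht hu.le
  have hd : ∀ x, x ∉ K → 0 < infDist x K := fun x hx => (hcl.notMem_iff_infDist_pos hne).1 hx
  set G : E3 → ℝ := K.piecewise (fun _ => 0) fun x => avg (infDist x K / 4) w x with hG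
  have hGK : ∀ x ∈ K, G x = 0 := fun x hx => piecewise_eq_of_mem _ _ _ hx
  have hGc : ∀ x, x ∉ K → G x = avg (infDist x K / 4) w x := fun x hx =>
    piecewise_eq_of_notMem _ _ _ hx
  have hloc : ∀ x, x ∉ K → G =ᶠ[𝓝 x] avg (infDist x K / 4) w := by
    intro x hx
    have hpos := hd x hx
    filter_upwards [hcl.isOpen_compl.mem_nhds hx,
      (continuous_infDist_pt K).continuousAt.eventually
        (lt_mem_nhds (show infDist x K / 2 < infDist x K by linarith))] with z hz hz2
    have := hd z hz
    rw [hGc z hz]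
    exact avg_eq_avg_of_weakly_harmonic hw hlap (by linarith) (by linarith) (by linarith)
  have hlower : ∀ x, x ∉ K → barrier x₀ R x ≤ G x := fun x hx => by
    have := hd x hx
    rw [hGc x hx]
    exact (hwK x _ (by linarith) (by linarith)).2.1
  have hupper : ∀ c ρ, 0 < ρ → closedBall c ρ ⊆ K → ∀ x, G x ≤ barrier c ρ x := by
    intro c ρ hρ hc x
    by_cases hx : x ∈ K
    · exact (hGK x hx).trans_le (le_max_left _ _)
    · have := hd x hx
      rw [hGc x hx]
      exact (hwK x _ (by linarith) (by linarith)).2.2 c ρ hρ hc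
  have hnonneg : ∀ x, 0 ≤ G x := fun x => by
    by_cases hx : x ∈ K
    · exact (hGK x hx).ge
    · exact (le_max_left _ _).trans (hlower x hx)
  refine ⟨G, fun x hxc => ContinuousAt.continuousWithinAt ?_, ⟨fun x hx => ?_, fun x hx => ?_⟩,
    fun p hp => ?_, ?_⟩
  · by_cases hx : x ∈ K
    · have hxf : x ∈ frontier K := by
        rw [frontier_eq_closure_inter_closure]
        exact ⟨subset_closure hx, hxc⟩
      obtain ⟨c, ρ, hρ, hc, hxρ⟩ := hball x hxf
      have hb : Tendsto (barrier c ρ) (𝓝 x) (𝓝 0) := by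
        rw [← barrier_of_ge hxρ.le]
        refine continuousAt_barrier ρ ?_
        rintro rfl
        simp [hρ.ne] at hxρ
      rw [ContinuousAt, hGK x hx]
      exact squeeze_zero hnonneg (hupper c ρ hρ hc) hb
    · exact (hsmooth _ (by linarith [hd x hx])).continuous.continuousAt.congr (hloc x hx).symm
  · exact ((hsmooth _ (by linarith [hd x hx])).contDiffAt.congr_of_eventuallyEq
      (hloc x hx)).contDiffWithinAt
  · have := hd x hx
    rw [laplacian_congr_of_eventuallyEq (hloc x hx)]
    exact hlap x _ (by linarith) (by linarith)
  · rw [frontier_compl] at hp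
    exact hGK p (hcl.frontier_subset hp)
  · obtain ⟨p, hp⟩ : (frontier K).Nonempty := by
      refine nonempty_frontier_iff.2 ⟨hne, ?_⟩
      rintro rfl
      exact noncompact_univ E3 hK
    obtain ⟨c, ρ, hρ, hc, -⟩ := hball p hp
    refine tendsto_of_tendsto_of_tendsto_of_le_of_le' (tendsto_barrier x₀ R) tendsto_const_nhds
      ?_ (Filter.Eventually.of_forall fun x =>
        (hupper c ρ hρ hc x).trans ((isUnitMeasurable_barrier c hρ.le).2 x).2)
    filter_upwards [hK.compl_mem_cocompact] with x hx
    exact hlower x hx
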